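/- For all natural numbers n and k, Σ over Motzkin prefixes P of length n and final height k of 2^{(number of level steps of P)} = C(2n, n−k) − C(2n, n−k−2), where C(·,·) is the binomial coefficient (zero on negative arguments). -/

import Mathlib

open Finset

inductive Step : Type
  | U | L | D
deriving DecidableEq

instance : Fintype Step where
  elems := {Step.U, Step.L, Step.D}
  complete := by intro x; cases x <;> simp

/-- The vertical displacement of a step: up = +1, level = 0, down = -1. -/
def Step.val : Step → ℤ
  | .U => 1
  | .L => 0
  | .D => -1

/-- The partial sum of the step values of the first `i` steps;
this is the height at which step `i` starts. -/
def hsum {n : ℕ} (P : Fin n → Step) (i : ℕ) : ℤ :=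
  ∑ j ∈ Finset.univ.filter (fun j : Fin n => (j : ℕ) < i), (P j).val

/-- A Motzkin path: all partial sums nonnegative and total sum 0. -/
abbrev IsMotzkin {n : ℕ} (P : Fin n → Step) : Prop :=
  (∀ i : Fin (n+1), 0 ≤ hsum P (i : ℕ)) ∧ hsum P n = 0

/-- A Motzkin prefix of final height `k`: all partial sums nonnegative, total sum `k`. -/
abbrev IsMPrefix {n : ℕ} (P : Fin n → Step) (k : ℕ) : Prop :=
  (∀ i : Fin (n+1), 0 ≤ hsum P (i : ℕ)) ∧ hsum P n = (k : ℤ)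

/-- `[h]_q = 1 + q + ... + q^(h-1)`. -/
def geo {R : Type*} [CommSemiring R] (q : R) (h : ℤ) : R :=
  ∑ i ∈ Finset.range h.toNat, q ^ i

/-- The Gaussian (q-)binomial coefficient, via the q-Pascal recurrence. -/
def qbinom {R : Type*} [CommSemiring R] (q : R) : ℕ → ℕ → R
  | _, 0 => 1
  | 0, _+1 => 0
  | n+1, k+1 => qbinom q n k + q ^ (k+1) * qbinom q n (k+1)

/-- The binomial coefficient with integer lower argument, zero on negative arguments. -/
def ch (m : ℕ) (j : ℤ) : ℤ := if 0 ≤ j then m.choose j.toNat else 0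

lemma hsum_snoc_le {n : ℕ} (P : Fin n → Step) (s : Step) (i : ℕ) (hi : i ≤ n) :
    hsum (Fin.snoc P s : Fin (n+1) → Step) i = hsum P i := by
  unfold hsum
  rw [Finset.sum_filter, Finset.sum_filter, Fin.sum_univ_castSucc]
  simp [Fin.snoc_castSucc, Fin.snoc_last]
  intro h; omega

lemma hsum_snoc_last {n : ℕ} (P : Fin n → Step) (s : Step) :
    hsum (Fin.snoc P s : Fin (n+1) → Step) (n+1) = hsum P n + s.val := by
  unfold hsum
  rw [Finset.sum_filter, Finset.sum_filter, Fin.sum_univ_castSucc]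
  simp only [Fin.snoc_castSucc, Fin.snoc_last, Fin.val_castSucc, Fin.val_last]
  have h : ∀ x : Fin n, (x : ℕ) < n + 1 := fun x => by omega
  simp [h]

def wt {n : ℕ} (P : Fin n → Step) : ℤ :=
  (2 : ℤ) ^ (Finset.univ.filter (fun i => P i = Step.L)).card

lemma wt_snoc {n : ℕ} (P : Fin n → Step) (s : Step) :
    wt (Fin.snoc P s : Fin (n+1) → Step) = wt P * (if s = Step.L then 2 else 1) := by
  unfold wt
  rw [Finset.card_filter, Finset.card_filter, Fin.sum_univ_castSucc, pow_add]
  simp only [Fin.snoc_castSucc, Fin.snoc_last]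
  split_ifs <;> simp

def good {n : ℕ} (P : Fin n → Step) (h : ℤ) : Prop :=
  (∀ i : Fin (n+1), 0 ≤ hsum P (i : ℕ)) ∧ hsum P n = h

instance {n : ℕ} (P : Fin n → Step) (h : ℤ) : Decidable (good P h) := by
  unfold good; infer_instance

lemma good_snoc {n : ℕ} (P : Fin n → Step) (s : Step) (h : ℤ) (hh : 0 ≤ h) :
    good (Fin.snoc P s : Fin (n+1) → Step) h ↔ good P (h - s.val) := by
  unfold good
  rw [Fin.forall_fin_succ', hsum_snoc_last]
  simp only [Fin.val_castSucc, Fin.val_last, hsum_snoc_last]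
  have h1 : ∀ i : Fin (n+1), hsum (Fin.snoc P s : Fin (n+1) → Step) (i : ℕ) = hsum P i :=
    fun i => hsum_snoc_le P s i (by omega)
  simp only [h1]
  constructor
  · rintro ⟨⟨a, b⟩, c⟩
    exact ⟨a, by omega⟩
  · rintro ⟨a, c⟩
    exact ⟨⟨a, by omega⟩, by omega⟩

def W (n : ℕ) (h : ℤ) : ℤ := ∑ P : Fin n → Step, if good P h then wt P else 0

lemma W_neg (n : ℕ) : W n (-1) = 0 := by
  unfold W
  apply Finset.sum_eq_zero
  intro P _
  rw [if_neg]
  rintro ⟨a, b⟩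
  have := a (Fin.last n)
  simp only [Fin.val_last] at this
  omega

lemma W_succ (n : ℕ) (h : ℤ) (hh : 0 ≤ h) :
    W (n+1) h = W n (h-1) + 2 * W n h + W n (h+1) := by
  unfold W
  rw [← (Fin.snocEquiv (fun _ : Fin (n+1) => Step)).sum_comp, Fintype.sum_prod_type]
  have hu : (Finset.univ : Finset Step) = {Step.U, Step.L, Step.D} := rfl
  have key : ∀ (s : Step) (P : Fin n → Step),
      (if good ((Fin.snocEquiv (fun _ : Fin (n+1) => Step)) (s, P)) h
        then wt ((Fin.snocEquiv (fun _ : Fin (n+1) => Step)) (s, P)) else 0)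
      = (if s = Step.L then 2 else 1) * (if good P (h - s.val) then wt P else 0) := by
    intro s P
    have e : (Fin.snocEquiv (fun _ : Fin (n+1) => Step)) (s, P)
        = (Fin.snoc P s : Fin (n+1) → Step) := rfl
    rw [e, wt_snoc]
    simp only [good_snoc P s h hh]
    split_ifs <;> ring
  simp only [key, hu, ← Finset.mul_sum]
  rw [Finset.sum_insert (by decide), Finset.sum_insert (by decide), Finset.sum_singleton]
  simp [Step.val]
  ring

lemma ch_succ (m : ℕ) (j : ℤ) : ch (m+1) j = ch m j + ch m (j-1) := by
  unfold ch
  rcases lt_trichotomy j 0 with h | h | h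
  · simp [show ¬ 0 ≤ j by omega, show ¬ 1 ≤ j by omega]
  · subst h; simp
  · obtain ⟨t, rfl⟩ : ∃ t : ℕ, j = t + 1 := ⟨(j-1).toNat, by omega⟩
    rw [if_pos (by omega), if_pos (by omega), if_pos (by omega)]
    rw [show ((t:ℤ)+1).toNat = t+1 by omega, show ((t:ℤ)+1-1).toNat = t by omega,
      Nat.choose_succ_succ]
    push_cast; ring

lemma ch_symm (n : ℕ) : ch (2*n) (n+1) = ch (2*n) (n-1) := by
  unfold ch
  rcases n with _ | n
  · simp
  · rw [if_pos (by omega), if_pos (by omega)]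
    congr 1
    apply Nat.choose_symm_of_eq_add
    omega

lemma W_eq (n : ℕ) : ∀ h : ℤ, -1 ≤ h →
    W n h = ch (2*n) ((n : ℤ) - h) - ch (2*n) ((n : ℤ) - h - 2) := by
  induction n with
  | zero =>
    intro h hh
    rcases eq_or_lt_of_le hh with rfl | hh
    · rw [W_neg]; simp [ch]
    · by_cases h0 : h = 0
      · subst h0
        simp [W, good, wt, hsum, ch]
      · have : ¬ (0 = h) := fun e => h0 e.symm
        simp [W, good, wt, hsum, ch, this]
        rw [if_neg (by omega), if_neg (by omega)]; rfl
  | succ n ih =>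
    intro h hh
    rcases eq_or_lt_of_le hh with rfl | hh
    · rw [W_neg]
      have := ch_symm (n+1)
      rw [show ((n+1:ℕ):ℤ) - -1 = ((n+1:ℕ):ℤ) + 1 by ring, this,
        show ((n+1:ℕ):ℤ) + 1 - 2 = ((n+1:ℕ):ℤ) - 1 by ring]
      ring
    · rw [W_succ n h (by omega), ih _ (by omega), ih _ (by omega), ih _ (by omega)]
      rw [show 2*(n+1) = 2*n+1+1 by ring]
      simp only [ch_succ]
      push_cast
      ring_nf

/-- The number of Motzkin prefixes of length `n` and final height `k`, with
every level step counted with weight `2`. -/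
theorem stmt12 (n k : ℕ) :
    (∑ P ∈ Finset.univ.filter (fun P : Fin n → Step => IsMPrefix P k),
        (2 : ℤ) ^ (Finset.univ.filter (fun i => P i = Step.L)).card)
    = ch (2*n) ((n : ℤ) - k) - ch (2*n) ((n : ℤ) - k - 2) := by
  rw [Finset.sum_filter]
  exact W_eq n k (by omega)
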